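/- Let p ∈ (2/3, 1) and let X be a random walk in the homogeneous 'have your cookie and eat it' environment ω ≡ p with X_0 = 1 almost surely. Then (3p − 2)/p ≤ P(T_0 = ∞) ≤ (3p − 2)/(p(2p − 1)). In particular P(T_0 = ∞) > 0, so the process is transient. -/

import Mathlib

open MeasureTheory Filter

noncomputable section

/-- The hitting time of site `x` by the process `X`, with value `⊤` if `x` is never hit. -/
def hitTime {Ω : Type*} (X : ℕ → Ω → ℤ) (x : ℤ) (ω : Ω) : ℕ∞ :=
  ⨅ (n : ℕ) (_ : X n ω = x), (n : ℕ∞)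

/-- The natural filtration of the process `X` at time `n`. -/
def natSA {Ω : Type*} (X : ℕ → Ω → ℤ) (n : ℕ) : MeasurableSpace Ω :=
  ⨆ m ∈ Finset.range (n + 1), MeasurableSpace.comap (X m) ⊤

/-- The event `A_n` that before time `n` the walk has never jumped leftward from its
current site `X_n`. -/
def freshEvent {Ω : Type*} (X : ℕ → Ω → ℤ) (n : ℕ) : Set Ω :=
  {ω | ∀ m < n, ¬(X m ω = X n ω ∧ X (m + 1) ω = X m ω - 1)}

/-- A random walk in the "have your cookie and eat it" environment `env`. -/
structure IsCookieRW {Ω : Type*} [MeasurableSpace Ω] (P : Measure Ω)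
    (env : ℤ → ℝ) (X : ℕ → Ω → ℤ) : Prop where
  envRange : ∀ x : ℤ, env x ∈ Set.Ico (1 / 2 : ℝ) 1
  meas : ∀ n, Measurable (X n)
  steps : ∀ n : ℕ, ∀ᵐ ω ∂P, |X (n + 1) ω - X n ω| = 1
  cond : ∀ n : ℕ,
    (P[Set.indicator {ω | X (n + 1) ω = X n ω + 1} (fun _ => (1 : ℝ)) | natSA X n])
      =ᵐ[P]
    fun ω => env (X n ω) * Set.indicator (freshEvent X n) (fun _ => (1 : ℝ)) ω
      + (1 / 2) * Set.indicator (freshEvent X n)ᶜ (fun _ => (1 : ℝ)) ω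

/-- The probability that the walk at `x` jumps right, when `B` is the set of sites from which it
has already jumped left. -/
def rightProb (p : ℝ) (x : ℤ) (B : Finset ℤ) : ℝ := if x ∈ B then 1 / 2 else p

/-- The one-step transition operator of the Markov chain (position, set of burnt sites). -/
def stepOp (p : ℝ) (f : ℤ → Finset ℤ → ℝ) (x : ℤ) (B : Finset ℤ) : ℝ :=
  rightProb p x B * f (x + 1) B + (1 - rightProb p x B) * f (x - 1) (insert x B)

lemma half_le_rightProb {p : ℝ} (hp : 1 / 2 ≤ p) (x : ℤ) (B : Finset ℤ) :
    1 / 2 ≤ rightProb p x B := by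
  unfold rightProb; split_ifs <;> linarith

lemma rightProb_le_one {p : ℝ} (hp : p ≤ 1) (x : ℤ) (B : Finset ℤ) : rightProb p x B ≤ 1 := by
  unfold rightProb; split_ifs <;> linarith

lemma stepOp_sub (p : ℝ) (f g : ℤ → Finset ℤ → ℝ) (x : ℤ) (B : Finset ℤ) :
    stepOp p (fun y C => f y C - g y C) x B = stepOp p f x B - stepOp p g x B := by
  unfold stepOp; ring

lemma stepOp_mono {p : ℝ} (hp : p ∈ Set.Icc (1 / 2 : ℝ) 1) {f g : ℤ → Finset ℤ → ℝ}
    (h : ∀ x B, f x B ≤ g x B) (x : ℤ) (B : Finset ℤ) : stepOp p f x B ≤ stepOp p g x B := by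
  have h1 := half_le_rightProb hp.1 x B
  have h2 := rightProb_le_one hp.2 x B
  unfold stepOp
  gcongr <;> first | linarith | exact h _ _

lemma stepOp_tendsto (p : ℝ) {f : ℕ → ℤ → Finset ℤ → ℝ} {g : ℤ → Finset ℤ → ℝ}
    (h : ∀ x B, Tendsto (fun k => f k x B) atTop (nhds (g x B))) (x : ℤ) (B : Finset ℤ) :
    Tendsto (fun k => stepOp p (f k) x B) atTop (nhds (stepOp p g x B)) :=
  ((h _ _).const_mul _).add ((h _ _).const_mul _)

lemma stepOp_nonneg {p : ℝ} (hp : p ∈ Set.Icc (1 / 2 : ℝ) 1) {f : ℤ → Finset ℤ → ℝ}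
    (h : ∀ x B, 0 ≤ f x B) (x : ℤ) (B : Finset ℤ) : 0 ≤ stepOp p f x B := by
  simpa [stepOp] using stepOp_mono hp (f := fun _ _ => 0) h x B

lemma stepOp_le_one {p : ℝ} (hp : p ∈ Set.Icc (1 / 2 : ℝ) 1) {f : ℤ → Finset ℤ → ℝ}
    (h : ∀ x B, f x B ≤ 1) (x : ℤ) (B : Finset ℤ) : stepOp p f x B ≤ 1 := by
  simpa [stepOp] using stepOp_mono hp (g := fun _ _ => 1) h x B

lemma maximum_principle_contract {p : ℝ} (hp : p ∈ Set.Icc (1 / 2 : ℝ) 1) {a n : ℤ} {C : ℝ}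
    (hC0 : 0 ≤ C) {f : ℤ → Finset ℤ → ℝ} (hC : ∀ x B, a ≤ x → x ≤ n → f x B ≤ C)
    (ha : ∀ B, f a B ≤ 0) (hn : ∀ B, f n B ≤ 0)
    (hf : ∀ x B, a < x → x < n → f x B ≤ stepOp p f x B) (d : ℕ) (B : Finset ℤ)
    (hd : a ≤ n - d) : f (n - d) B ≤ C * (1 - (1 / 2) ^ d) := by
  induction d generalizing B with
  | zero => simpa using hn B
  | succ d ih =>
    push_cast at hd ⊢
    rcases hd.eq_or_lt with h | h
    · rw [← h]
      refine (ha B).trans (mul_nonneg hC0 ?_)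
      linarith [pow_le_one₀ (n := d + 1) (by norm_num : (0 : ℝ) ≤ 1 / 2) (by norm_num)]
    · have h1 := half_le_rightProb hp.1 (n - (d + 1)) B
      have h2 := rightProb_le_one hp.2 (n - (d + 1)) B
      have h3 := hf _ B h (by omega)
      have h4 := ih B (by omega)
      have h5 := hC (n - (d + 1) - 1) (insert (n - (d + 1)) B) (by omega) (by omega)
      unfold stepOp at h3
      rw [show n - ((d : ℤ) + 1) + 1 = n - d by ring] at h3
      set w := rightProb p (n - (d + 1)) B
      have h6 : w * f (n - d) B ≤ w * (C * (1 - (1 / 2) ^ d)) :=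
        mul_le_mul_of_nonneg_left h4 (by linarith)
      have h7 := mul_le_mul_of_nonneg_left h5 (sub_nonneg.2 h2)
      have h8 : 0 ≤ (w - 1 / 2) * (C * (1 / 2) ^ d) :=
        mul_nonneg (by linarith) (by positivity)
      rw [pow_succ]
      nlinarith

/-- A bounded subharmonic function on `[a, n]` with nonpositive boundary values is nonpositive. -/
lemma maximum_principle {p : ℝ} (hp : p ∈ Set.Icc (1 / 2 : ℝ) 1) {a n : ℤ} {C : ℝ}
    {f : ℤ → Finset ℤ → ℝ} (hC : ∀ x B, a ≤ x → x ≤ n → f x B ≤ C)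
    (ha : ∀ B, f a B ≤ 0) (hn : ∀ B, f n B ≤ 0)
    (hf : ∀ x B, a < x → x < n → f x B ≤ stepOp p f x B) (x : ℤ) (B : Finset ℤ)
    (hax : a ≤ x) (hxn : x ≤ n) : f x B ≤ 0 := by
  set N := (n - a).toNat
  set r : ℝ := 1 - (1 / 2) ^ N
  have hpow : (1 / 2 : ℝ) ^ N ≤ 1 := pow_le_one₀ (by norm_num) (by norm_num)
  have hpos : (0 : ℝ) < (1 / 2) ^ N := by positivity
  have key : ∀ k : ℕ, ∀ x B, a ≤ x → x ≤ n → f x B ≤ |C| * r ^ k := by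
    intro k
    induction k with
    | zero => intro x B h1 h2; simpa using (hC x B h1 h2).trans (le_abs_self C)
    | succ k ih =>
      intro x B h1 h2
      have hr : 0 ≤ r := by simp only [r]; linarith
      have := maximum_principle_contract hp (mul_nonneg (abs_nonneg C) (pow_nonneg hr k)) ih ha hn
        hf (n - x).toNat B (by omega)
      rw [show n - ((n - x).toNat : ℤ) = x by omega] at this
      refine this.trans ?_
      rw [pow_succ, ← mul_assoc]
      refine mul_le_mul_of_nonneg_left ?_ (mul_nonneg (abs_nonneg C) (pow_nonneg hr k))
      have : (1 / 2 : ℝ) ^ N ≤ (1 / 2) ^ (n - x).toNat :=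
        pow_le_pow_of_le_one (by norm_num) (by norm_num) (by omega)
      simp only [r]; linarith
  have hlim : Tendsto (fun k : ℕ => |C| * r ^ k) atTop (nhds (|C| * 0)) :=
    (tendsto_pow_atTop_nhds_zero_of_lt_one (by simp only [r]; linarith)
      (by simp only [r]; linarith)).const_mul _
  rw [mul_zero] at hlim
  exact ge_of_tendsto' hlim fun k => key k x B hax hxn

/-- The probability, starting from `x` with burnt sites `B`, of reaching `[n, ∞)` before
`(-∞, a]` and within `k` steps. -/
def hitAboveWithin (p : ℝ) (a n : ℤ) : ℕ → ℤ → Finset ℤ → ℝ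
  | 0, x, _ => if x ≤ a then 0 else if n ≤ x then 1 else 0
  | k + 1, x, B =>
    if x ≤ a then 0 else if n ≤ x then 1 else stepOp p (hitAboveWithin p a n k) x B

/-- The probability, starting from `x` with burnt sites `B`, of reaching `[n, ∞)` before
`(-∞, a]`. -/
def hitAbove (p : ℝ) (a n x : ℤ) (B : Finset ℤ) : ℝ := ⨆ k, hitAboveWithin p a n k x B

section hitAbove

variable {p : ℝ} {a n : ℤ}

lemma hitAboveWithin_mem (hp : p ∈ Set.Icc (1 / 2 : ℝ) 1) (k : ℕ) (x : ℤ) (B : Finset ℤ) :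
    hitAboveWithin p a n k x B ∈ Set.Icc (0 : ℝ) 1 := by
  induction k generalizing x B with
  | zero => unfold hitAboveWithin; split_ifs <;> simp
  | succ k ih =>
    unfold hitAboveWithin
    split_ifs
    · simp
    · simp
    · exact ⟨stepOp_nonneg hp (fun x B => (ih x B).1) x B,
        stepOp_le_one hp (fun x B => (ih x B).2) x B⟩

lemma hitAboveWithin_le_succ (hp : p ∈ Set.Icc (1 / 2 : ℝ) 1) (k : ℕ) (x : ℤ) (B : Finset ℤ) :
    hitAboveWithin p a n k x B ≤ hitAboveWithin p a n (k + 1) x B := by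
  induction k generalizing x B with
  | zero =>
    unfold hitAboveWithin
    split_ifs
    · rfl
    · rfl
    · exact stepOp_nonneg hp (fun x B => (hitAboveWithin_mem hp 0 x B).1) x B
  | succ k ih =>
    rw [hitAboveWithin, hitAboveWithin]
    split_ifs
    · rfl
    · rfl
    · exact stepOp_mono hp ih x B

lemma tendsto_hitAbove (hp : p ∈ Set.Icc (1 / 2 : ℝ) 1) (x : ℤ) (B : Finset ℤ) :
    Tendsto (fun k => hitAboveWithin p a n k x B) atTop (nhds (hitAbove p a n x B)) :=
  tendsto_atTop_ciSup (monotone_nat_of_le_succ fun k => hitAboveWithin_le_succ hp k x B)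
    ⟨1, by rintro _ ⟨k, rfl⟩; exact (hitAboveWithin_mem hp k x B).2⟩

lemma hitAbove_mem (hp : p ∈ Set.Icc (1 / 2 : ℝ) 1) (x : ℤ) (B : Finset ℤ) :
    hitAbove p a n x B ∈ Set.Icc (0 : ℝ) 1 :=
  isClosed_Icc.mem_of_tendsto (tendsto_hitAbove hp x B)
    (Eventually.of_forall fun k => hitAboveWithin_mem hp k x B)

lemma hitAbove_of_le {x : ℤ} (h : x ≤ a) (B : Finset ℤ) : hitAbove p a n x B = 0 := by
  have : ∀ k, hitAboveWithin p a n k x B = 0 := by rintro (_ | k) <;> simp [hitAboveWithin, h]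
  simp [hitAbove, this]

lemma hitAbove_of_ge {x : ℤ} (ha : a < x) (h : n ≤ x) (B : Finset ℤ) :
    hitAbove p a n x B = 1 := by
  have : ∀ k, hitAboveWithin p a n k x B = 1 := by
    rintro (_ | k) <;> simp [hitAboveWithin, h, ha.not_ge]
  simp [hitAbove, this]

lemma hitAbove_eq_stepOp (hp : p ∈ Set.Icc (1 / 2 : ℝ) 1) {x : ℤ} (ha : a < x) (hn : x < n)
    (B : Finset ℤ) : hitAbove p a n x B = stepOp p (hitAbove p a n) x B := by
  have h1 := (tendsto_add_atTop_iff_nat 1).2 (tendsto_hitAbove (a := a) (n := n) hp x B)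
  have h2 := stepOp_tendsto p (tendsto_hitAbove (a := a) (n := n) hp) x B
  refine tendsto_nhds_unique (h1.congr fun k => ?_) h2
  simp [hitAboveWithin, ha.not_ge, hn.not_ge]

lemma hitAboveWithin_congr (k : ℕ) (x : ℤ) {B B' : Finset ℤ}
    (h : ∀ z, a < z → z < n → (z ∈ B ↔ z ∈ B')) :
    hitAboveWithin p a n k x B = hitAboveWithin p a n k x B' := by
  induction k generalizing x B B' with
  | zero => rfl
  | succ k ih =>
    rw [hitAboveWithin, hitAboveWithin]
    split_ifs with h1 h2
    · rfl
    · rfl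
    · have hx := h x (by omega) (by omega)
      unfold stepOp rightProb
      rw [ih _ h, ih (x - 1) (B := insert x B) (B' := insert x B')]
      · simp only [hx]
      · intro z hz hz'
        simp only [Finset.mem_insert, h z hz hz']

lemma hitAbove_congr (x : ℤ) {B B' : Finset ℤ} (h : ∀ z, a < z → z < n → (z ∈ B ↔ z ∈ B')) :
    hitAbove p a n x B = hitAbove p a n x B' :=
  iSup_congr fun k => hitAboveWithin_congr k x h

lemma hitAboveWithin_add (t : ℤ) (k : ℕ) (x : ℤ) {B B' : Finset ℤ}
    (h : ∀ z, z + t ∈ B' ↔ z ∈ B) :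
    hitAboveWithin p (a + t) (n + t) k (x + t) B' = hitAboveWithin p a n k x B := by
  induction k generalizing x B B' with
  | zero => simp [hitAboveWithin]
  | succ k ih =>
    have h1 := ih (x + 1) h
    have h2 := ih (x - 1) (B := insert x B) (B' := insert (x + t) B')
      (fun z => by simp [h])
    simp only [hitAboveWithin, add_le_add_iff_right, stepOp, rightProb, h]
    rw [show x + t + 1 = x + 1 + t by ring, h1, show x + t - 1 = x - 1 + t by ring, h2]

lemma hitAbove_add_empty (t x : ℤ) :
    hitAbove p (a + t) (n + t) (x + t) ∅ = hitAbove p a n x ∅ :=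
  iSup_congr fun k => hitAboveWithin_add t k x (by simp)

end hitAbove

/-- The probability, starting from `y` with burnt sites `B`, that the walk jumps left from `x` for
the first time before hitting `0` or `n`. -/
def burnProb (p : ℝ) (n x y : ℤ) (B : Finset ℤ) : ℝ :=
  if x ∈ B then 0
  else if y < x then hitAbove p 0 x y B * (1 - hitAbove p (x - 1) n x B)
  else 1 - hitAbove p (x - 1) n y B

lemma burnProb_mem {p : ℝ} (hp : p ∈ Set.Icc (1 / 2 : ℝ) 1) (n x y : ℤ) (B : Finset ℤ) :
    burnProb p n x y B ∈ Set.Icc (0 : ℝ) 1 := by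
  unfold burnProb
  have h1 := hitAbove_mem (a := 0) (n := x) hp y B
  have h2 := hitAbove_mem (a := x - 1) (n := n) hp x B
  have h3 := hitAbove_mem (a := x - 1) (n := n) hp y B
  split_ifs
  · simp
  · exact ⟨mul_nonneg h1.1 (by linarith [h2.2]),
      mul_le_one₀ h1.2 (by linarith [h2.2]) (by linarith [h2.1])⟩
  · exact ⟨by linarith [h3.2], by linarith [h3.1]⟩

lemma burnProb_sub_stepOp {p : ℝ} (hp : p ∈ Set.Icc (1 / 2 : ℝ) 1) {n x y : ℤ}
    (hx0 : 0 < x) (hxn : x < n) (hy0 : 0 < y) (hyn : y < n) (B : Finset ℤ) :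
    burnProb p n x y B - stepOp p (burnProb p n x) y B
      = if y = x ∧ x ∉ B then 1 - p else 0 := by
  by_cases hxB : x ∈ B
  · simp [burnProb, stepOp, hxB]
  rcases lt_trichotomy y x with hlt | rfl | hgt
  · have hup : burnProb p n x (y + 1) B
        = hitAbove p 0 x (y + 1) B * (1 - hitAbove p (x - 1) n x B) := by
      rcases (show y + 1 ≤ x by omega).lt_or_eq with h | h
      · simp [burnProb, hxB, h]
      · simp [burnProb, hxB, h, hitAbove_of_ge hx0 le_rfl]
    have hdown : burnProb p n x (y - 1) (insert y B)
        = hitAbove p 0 x (y - 1) (insert y B) * (1 - hitAbove p (x - 1) n x B) := by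
      rw [hitAbove_congr (a := x - 1) (n := n) x (B := B) (B' := insert y B)]
      · simp [burnProb, hxB, hlt.ne', show y - 1 < x by omega]
      · intro z hz _
        simp [show z ≠ y by omega]
    rw [stepOp, hup, hdown, burnProb, if_neg hxB, if_pos hlt,
      hitAbove_eq_stepOp hp hy0 hlt, stepOp, if_neg (by simp [hlt.ne])]
    ring
  · have h := hitAbove_eq_stepOp hp (show y - 1 < y by omega) hyn B
    rw [stepOp, hitAbove_of_le (le_refl (y - 1)), rightProb, if_neg hxB] at h
    have h0 : burnProb p n y y B = 1 - hitAbove p (y - 1) n y B := by simp [burnProb, hxB]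
    have h1 : burnProb p n y (y + 1) B = 1 - hitAbove p (y - 1) n (y + 1) B := by
      rw [burnProb, if_neg hxB, if_neg (by omega)]
    have h2 : burnProb p n y (y - 1) (insert y B) = 0 := by simp [burnProb]
    rw [stepOp, h0, h1, h2, h, rightProb, if_neg hxB, if_pos ⟨rfl, hxB⟩]
    ring
  · have h := hitAbove_eq_stepOp hp (show x - 1 < y by omega) hyn B
    have h0 : burnProb p n x y B = 1 - hitAbove p (x - 1) n y B := by
      rw [burnProb, if_neg hxB, if_neg (by omega)]
    have h1 : burnProb p n x (y + 1) B = 1 - hitAbove p (x - 1) n (y + 1) B := by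
      rw [burnProb, if_neg hxB, if_neg (by omega)]
    have h2 : burnProb p n x (y - 1) (insert y B)
        = 1 - hitAbove p (x - 1) n (y - 1) (insert y B) := by
      rw [burnProb, if_neg (by simp [hxB, hgt.ne]), if_neg (by omega)]
    rw [stepOp, h0, h1, h2, h, stepOp, if_neg (by simp [hgt.ne'])]
    ring

/-- The drift identity: the expected exit position from `(0, n)` is the starting point plus the
expected accumulated drift. -/
lemma mul_hitAbove_eq {p : ℝ} (hp : p ∈ Set.Ico (1 / 2 : ℝ) 1) {n : ℤ} (hn : 0 < n) (y : ℤ)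
    (B : Finset ℤ) (hy0 : 0 ≤ y) (hyn : y ≤ n) :
    n * hitAbove p 0 n y B
      = y + (2 * p - 1) / (1 - p) * ∑ x ∈ Finset.Ioo 0 n, burnProb p n x y B := by
  have hp' : p ∈ Set.Icc (1 / 2 : ℝ) 1 := ⟨hp.1, hp.2.le⟩
  set c := (2 * p - 1) / (1 - p) with hc
  have hp1 : 0 < 1 - p := by linarith [hp.2]
  have hcp : c * (1 - p) = 2 * p - 1 := div_mul_cancel₀ _ hp1.ne'
  have hc0 : 0 ≤ c := div_nonneg (by linarith [hp.1]) hp1.le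
  set f : ℤ → Finset ℤ → ℝ := fun y B =>
    n * hitAbove p 0 n y B - y - c * ∑ x ∈ Finset.Ioo 0 n, burnProb p n x y B with hf
  have hfa : ∀ B, f 0 B = 0 := by
    intro B
    have : ∀ x ∈ Finset.Ioo 0 n, burnProb p n x 0 B = 0 := by
      intro x hx
      simp [burnProb, (Finset.mem_Ioo.1 hx).1, hitAbove_of_le (le_refl (0 : ℤ))]
    simp [hf, Finset.sum_eq_zero this, hitAbove_of_le (le_refl (0 : ℤ))]
  have hfn : ∀ B, f n B = 0 := by
    intro B
    have : ∀ x ∈ Finset.Ioo 0 n, burnProb p n x n B = 0 := by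
      intro x hx
      have := Finset.mem_Ioo.1 hx
      simp [burnProb, this.2.not_gt, hitAbove_of_ge (show x - 1 < n by omega) le_rfl]
    simp [hf, Finset.sum_eq_zero this, hitAbove_of_ge hn le_rfl]
  have hharm : ∀ y B, 0 < y → y < n → f y B = stepOp p f y B := by
    intro y B h0 h1
    have hs : ∑ x ∈ Finset.Ioo 0 n, burnProb p n x y B
        - ∑ x ∈ Finset.Ioo 0 n, stepOp p (burnProb p n x) y B
        = if y ∈ B then 0 else 1 - p := by
      rw [← Finset.sum_sub_distrib, Finset.sum_congr rfl fun x hx =>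
        burnProb_sub_stepOp hp' (Finset.mem_Ioo.1 hx).1 (Finset.mem_Ioo.1 hx).2 h0 h1 B]
      rw [Finset.sum_eq_single y]
      · simp [ite_not]
      · intro x _ hxy; simp [hxy.symm]
      · intro h; exact absurd (Finset.mem_Ioo.2 ⟨h0, h1⟩) h
    have hstep : stepOp p f y B = n * stepOp p (hitAbove p 0 n) y B
        - (y + (2 * rightProb p y B - 1))
        - c * ∑ x ∈ Finset.Ioo 0 n, stepOp p (burnProb p n x) y B := by
      simp only [stepOp, hf, Finset.sum_add_distrib, ← Finset.mul_sum]
      push_cast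
      ring
    rw [hstep, ← hitAbove_eq_stepOp hp' h0 h1]
    have hw : 2 * rightProb p y B - 1 = c * if y ∈ B then 0 else 1 - p := by
      unfold rightProb
      split_ifs
      · norm_num
      · rw [hcp]
    rw [hw, ← hs]
    simp only [hf]
    ring
  have hbound : ∀ y B, 0 ≤ y → y ≤ n → |f y B| ≤ n + n + c * n := by
    intro y B h0 h1
    have h2 := hitAbove_mem (a := 0) (n := n) hp' y B
    have hs0 : 0 ≤ ∑ x ∈ Finset.Ioo 0 n, burnProb p n x y B :=
      Finset.sum_nonneg fun x _ => (burnProb_mem hp' n x y B).1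
    have hs1 : ∑ x ∈ Finset.Ioo 0 n, burnProb p n x y B ≤ n := by
      refine (Finset.sum_le_sum fun x _ => (burnProb_mem hp' n x y B).2).trans ?_
      rw [Finset.sum_const, nsmul_eq_mul, mul_one, Int.card_Ioo]
      have : (((n - 0 - 1).toNat : ℤ) : ℝ) ≤ (n : ℝ) := by exact_mod_cast (by omega)
      simpa using this
    have hn' : (0 : ℝ) < n := by exact_mod_cast hn
    have h0' : (0 : ℝ) ≤ y := by exact_mod_cast h0
    have h1' : (y : ℝ) ≤ n := by exact_mod_cast h1
    have h3 := mul_le_mul_of_nonneg_left hs1 hc0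
    have h4 := mul_nonneg hc0 hs0
    have h5 := mul_le_mul_of_nonneg_left h2.2 hn'.le
    have h6 := mul_nonneg hn'.le h2.1
    rw [abs_le]
    simp only [hf]
    constructor <;> linarith [mul_nonneg hc0 hn'.le]
  have hle := maximum_principle hp' (fun y B h0 h1 => (abs_le.1 (hbound y B h0 h1)).2)
    (fun B => (hfa B).le) (fun B => (hfn B).le) (fun y B h0 h1 => (hharm y B h0 h1).le) y B hy0 hyn
  have hge := maximum_principle (f := fun y B => 0 - f y B) (C := n + n + c * n) hp'
    (fun y B h0 h1 => by linarith [(abs_le.1 (hbound y B h0 h1)).1])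
    (fun B => by simp [hfa B]) (fun B => by simp [hfn B])
    (fun y B h0 h1 => by
      rw [stepOp_sub, ← hharm y B h0 h1]
      simp [stepOp]) y B hy0 hyn
  simp only [hf] at hle hge
  linarith

/-- The probability of first reaching height `n` before `0`, starting at `1` with no burnt sites. -/
def reachProb (p : ℝ) (n : ℕ) : ℝ := hitAbove p 0 n 1 ∅

lemma burnProb_one_empty {p : ℝ} {n x : ℤ} (hx : 0 < x) :
    burnProb p n x 1 ∅ = hitAbove p 0 x 1 ∅ * (1 - hitAbove p 0 (n + 1 - x) 1 ∅) := by
  have h := hitAbove_add_empty (p := p) (a := 0) (n := n + 1 - x) (x - 1) 1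
  rw [show (0 : ℤ) + (x - 1) = x - 1 by ring, show n + 1 - x + (x - 1) = n by ring,
    show 1 + (x - 1) = x by ring] at h
  rw [burnProb, if_neg (by simp)]
  split_ifs with h1
  · rw [h]
  · obtain rfl : x = 1 := by omega
    rw [hitAbove_of_ge one_pos le_rfl, h, one_mul]

lemma mul_reachProb_eq {p : ℝ} (hp : p ∈ Set.Ico (1 / 2 : ℝ) 1) {n : ℕ} (hn : 1 ≤ n) :
    n * reachProb p n = 1 + (2 * p - 1) / (1 - p) *
      ∑ x ∈ Finset.Ico 1 n, reachProb p x * (1 - reachProb p (n + 1 - x)) := by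
  have h := mul_hitAbove_eq hp (n := n) (by exact_mod_cast hn) 1 ∅ zero_le_one
    (by exact_mod_cast hn)
  simp only [Int.cast_natCast, Int.cast_one] at h
  rw [reachProb, h]
  congr 2
  symm
  refine Finset.sum_bij (fun (x : ℕ) _ => (x : ℤ)) ?_ ?_ ?_ ?_
  · intro x hx
    simp only [Finset.mem_Ico, Finset.mem_Ioo] at hx ⊢
    omega
  · intro x _ y _ hxy
    exact_mod_cast hxy
  · intro x hx
    simp only [Finset.mem_Ioo] at hx
    exact ⟨x.toNat, by simp only [Finset.mem_Ico]; omega, by omega⟩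
  · intro x hx
    simp only [Finset.mem_Ico] at hx
    rw [burnProb_one_empty (by omega), reachProb, reachProb]
    congr 4
    omega

/-- The probability, starting from `x` with burnt sites `B`, of staying positive for `k` steps. -/
def survivalProb (p : ℝ) : ℕ → ℤ → Finset ℤ → ℝ
  | 0, x, _ => if x ≤ 0 then 0 else 1
  | k + 1, x, B => if x ≤ 0 then 0 else stepOp p (survivalProb p k) x B

lemma survivalProb_mem {p : ℝ} (hp : p ∈ Set.Icc (1 / 2 : ℝ) 1) (k : ℕ) (x : ℤ) (B : Finset ℤ) :
    survivalProb p k x B ∈ Set.Icc (0 : ℝ) 1 := by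
  induction k generalizing x B with
  | zero => unfold survivalProb; split_ifs <;> simp
  | succ k ih =>
    unfold survivalProb
    split_ifs
    · simp
    · exact ⟨stepOp_nonneg hp (fun x B => (ih x B).1) x B,
        stepOp_le_one hp (fun x B => (ih x B).2) x B⟩

lemma survivalProb_succ_le {p : ℝ} (hp : p ∈ Set.Icc (1 / 2 : ℝ) 1) (k : ℕ) (x : ℤ)
    (B : Finset ℤ) : survivalProb p (k + 1) x B ≤ survivalProb p k x B := by
  induction k generalizing x B with
  | zero =>
    unfold survivalProb
    split_ifs
    · rfl
    · exact stepOp_le_one hp (fun x B => (survivalProb_mem hp 0 x B).2) x B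
  | succ k ih =>
    rw [survivalProb, survivalProb]
    split_ifs
    · rfl
    · exact stepOp_mono hp ih x B

lemma survivalProb_of_nonpos {p : ℝ} (k : ℕ) {x : ℤ} (hx : x ≤ 0) (B : Finset ℤ) :
    survivalProb p k x B = 0 := by
  cases k <;> simp [survivalProb, hx]

/-- The probability, starting from `x` with burnt sites `B`, of staying positive forever. -/
def survivalLim (p : ℝ) (x : ℤ) (B : Finset ℤ) : ℝ := ⨅ k, survivalProb p k x B

lemma tendsto_survivalProb {p : ℝ} (hp : p ∈ Set.Icc (1 / 2 : ℝ) 1) (x : ℤ) (B : Finset ℤ) :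
    Tendsto (fun k => survivalProb p k x B) atTop (nhds (survivalLim p x B)) :=
  tendsto_atTop_ciInf (antitone_nat_of_succ_le fun k => survivalProb_succ_le hp k x B)
    ⟨0, by rintro _ ⟨k, rfl⟩; exact (survivalProb_mem hp k x B).1⟩

lemma survivalLim_le_one {p : ℝ} (hp : p ∈ Set.Icc (1 / 2 : ℝ) 1) (x : ℤ) (B : Finset ℤ) :
    survivalLim p x B ≤ 1 :=
  le_of_tendsto' (tendsto_survivalProb hp x B) fun k => (survivalProb_mem hp k x B).2

lemma survivalLim_eq_stepOp {p : ℝ} (hp : p ∈ Set.Icc (1 / 2 : ℝ) 1) {x : ℤ} (hx : 0 < x)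
    (B : Finset ℤ) : survivalLim p x B = stepOp p (survivalLim p) x B := by
  have h1 := (tendsto_add_atTop_iff_nat 1).2 (tendsto_survivalProb hp x B)
  have h2 := stepOp_tendsto p (tendsto_survivalProb hp) x B
  refine tendsto_nhds_unique (h1.congr fun k => ?_) h2
  simp [survivalProb, hx.not_ge]

lemma survivalLim_le_hitAbove {p : ℝ} (hp : p ∈ Set.Icc (1 / 2 : ℝ) 1) {n : ℤ} (hn : 0 < n)
    (x : ℤ) (B : Finset ℤ) (hx0 : 0 ≤ x) (hxn : x ≤ n) :
    survivalLim p x B ≤ hitAbove p 0 n x B := by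
  refine sub_nonpos.1 (maximum_principle (f := fun x B => survivalLim p x B - hitAbove p 0 n x B)
    (a := 0) (n := n) (C := 1) hp ?_ ?_ ?_ ?_ x B hx0 hxn)
  · intro x B _ _
    linarith [survivalLim_le_one hp x B, (hitAbove_mem (a := 0) (n := n) hp x B).1]
  · intro B
    simp [survivalLim, survivalProb_of_nonpos, hitAbove_of_le]
  · intro B
    rw [hitAbove_of_ge hn le_rfl]
    linarith [survivalLim_le_one hp n B]
  · intro x B h0 h1
    rw [stepOp_sub, ← hitAbove_eq_stepOp hp h0 h1, ← survivalLim_eq_stepOp hp h0]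

lemma hitAbove_le_survivalProb {p : ℝ} (hp : p ∈ Set.Icc (1 / 2 : ℝ) 1) {n : ℤ} (k : ℕ) (x : ℤ)
    (B : Finset ℤ) (h : x + k ≤ n) : hitAbove p 0 n x B ≤ survivalProb p k x B := by
  induction k generalizing x B with
  | zero =>
    unfold survivalProb
    split_ifs with hx
    · rw [hitAbove_of_le hx]
    · exact (hitAbove_mem hp x B).2
  | succ k ih =>
    unfold survivalProb
    split_ifs with hx
    · rw [hitAbove_of_le hx]
    · push_cast at h
      rw [hitAbove_eq_stepOp hp (by omega) (by omega)]
      have h1 := half_le_rightProb hp.1 x B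
      have h2 := rightProb_le_one hp.2 x B
      unfold stepOp
      gcongr <;> exact ih _ _ (by omega)

lemma reachProb_succ_le {p : ℝ} (hp : p ∈ Set.Icc (1 / 2 : ℝ) 1) {n : ℕ} (hn : 1 ≤ n) :
    reachProb p (n + 1) ≤ reachProb p n := by
  have hn' : (1 : ℤ) ≤ n := by exact_mod_cast hn
  refine sub_nonpos.1 (maximum_principle
    (f := fun x B => hitAbove p 0 (n + 1 : ℕ) x B - hitAbove p 0 n x B)
    (a := 0) (n := n) (C := 1) hp ?_ ?_ ?_ ?_ 1 ∅ zero_le_one hn')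
  · intro x B _ _
    linarith [(hitAbove_mem (a := 0) (n := (n + 1 : ℕ)) hp x B).2,
      (hitAbove_mem (a := 0) (n := n) hp x B).1]
  · intro B
    simp [hitAbove_of_le]
  · intro B
    rw [hitAbove_of_ge (by omega) (le_refl (n : ℤ))]
    linarith [(hitAbove_mem (a := 0) (n := (n + 1 : ℕ)) hp n B).2]
  · intro x B h0 h1
    rw [stepOp_sub, ← hitAbove_eq_stepOp hp h0 h1,
      ← hitAbove_eq_stepOp hp h0 (by push_cast; omega)]

lemma tendsto_reachProb {p : ℝ} (hp : p ∈ Set.Icc (1 / 2 : ℝ) 1) :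
    Tendsto (reachProb p) atTop (nhds (survivalLim p 1 ∅)) := by
  refine (tendsto_add_atTop_iff_nat 1).1 (tendsto_of_tendsto_of_tendsto_of_le_of_le
    tendsto_const_nhds (tendsto_survivalProb hp 1 ∅) (fun n => ?_) fun n => ?_)
  · exact survivalLim_le_hitAbove hp (by omega) 1 ∅ zero_le_one (by omega)
  · exact hitAbove_le_survivalProb hp n 1 ∅ (by push_cast; omega)

lemma sum_Ico_one_reflect (f : ℕ → ℝ) (n : ℕ) :
    ∑ x ∈ Finset.Ico 1 n, f (n + 1 - x) = ∑ x ∈ Finset.Ico 1 n, f (x + 1) := by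
  refine Finset.sum_nbij' (fun x => n - x) (fun x => n - x) ?_ ?_ ?_ ?_ ?_ <;>
    · intro x hx
      simp only [Finset.mem_Ico] at hx ⊢
      first
      | omega
      | (congr 1; omega)

lemma tendsto_sum_Ico_div {u : ℕ → ℝ} {l : ℝ} (h : Tendsto u atTop (nhds l)) :
    Tendsto (fun n : ℕ => (∑ x ∈ Finset.Ico 1 n, u x) / n) atTop (nhds l) := by
  have h1 := h.cesaro
  have h2 : Tendsto (fun n : ℕ => u 0 / n) atTop (nhds 0) := tendsto_const_div_atTop_nhds_zero_nat _
  have h3 := h1.sub h2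
  rw [sub_zero] at h3
  refine h3.congr' ?_
  filter_upwards [eventually_ge_atTop 1] with n hn
  rw [Finset.range_eq_Ico, Finset.sum_eq_sum_Ico_succ_bot hn]
  ring

/-- The limit of an antitone sequence in `[0, 1]` solving the renewal-type equation
`n qₙ = 1 + c ∑ qₓ (1 - qₙ₊₁₋ₓ)` with `c > 1` is `1 - 1 / c`. -/
lemma limit_of_renewal {q : ℕ → ℝ} {c ρ : ℝ} (hc : 1 < c)
    (hq0 : ∀ n, 0 ≤ q n) (hq1 : ∀ n, q n ≤ 1) (hone : q 1 = 1)
    (hanti : ∀ n, 1 ≤ n → q (n + 1) ≤ q n) (hlim : Tendsto q atTop (nhds ρ))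
    (hrec : ∀ n, 1 ≤ n →
      n * q n = 1 + c * ∑ x ∈ Finset.Ico 1 n, q x * (1 - q (n + 1 - x))) :
    c * (1 - ρ) = 1 := by
  have hanti' : ∀ m n, 1 ≤ m → m ≤ n → q n ≤ q m := by
    intro m n hm hmn
    induction n, hmn using Nat.le_induction with
    | base => rfl
    | succ n hmn ih => exact (hanti n (hm.trans hmn)).trans ih
  have hρ : ∀ n, 1 ≤ n → ρ ≤ q n := fun n hn =>
    le_of_tendsto hlim (eventually_atTop.2 ⟨n, fun m hm => hanti' n m hn hm⟩)
  have hρ0 : 0 ≤ ρ := ge_of_tendsto' hlim hq0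
  have hρpos : 0 < ρ := by
    refine hρ0.lt_of_ne fun h0 => ?_
    set ε := (c - 1) / (4 * c) with hε
    have hε0 : 0 < ε := div_pos (by linarith) (by linarith)
    have hcε : 4 * (c * ε) = c - 1 := by rw [hε]; field_simp
    obtain ⟨m, hm⟩ := eventually_atTop.1 (hlim.eventually_lt_const (h0 ▸ hε0 : ρ < ε))
    set n := 2 * m + 2 with hn
    set S := ∑ x ∈ Finset.Ico 1 n, q x with hS
    have hS1 : 1 ≤ S := by
      rw [← hone, hS]
      exact Finset.single_le_sum (f := q) (fun x _ => hq0 x) (by simp [hn])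
    have hconv : ∑ x ∈ Finset.Ico 1 n, q x * q (n + 1 - x) ≤ ε * (S + S) := by
      calc ∑ x ∈ Finset.Ico 1 n, q x * q (n + 1 - x)
          ≤ ∑ x ∈ Finset.Ico 1 n, ε * (q x + q (n + 1 - x)) := by
            refine Finset.sum_le_sum fun x _ => ?_
            have h1 := hq0 x
            have h2 := hq0 (n + 1 - x)
            rcases le_total m x with h | h
            · nlinarith [hm x h, mul_nonneg hε0.le h1]
            · nlinarith [hm (n + 1 - x) (by omega), mul_nonneg hε0.le h2]
        _ = ε * (S + ∑ x ∈ Finset.Ico 1 n, q (x + 1)) := by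
            rw [← Finset.mul_sum, Finset.sum_add_distrib, sum_Ico_one_reflect]
        _ ≤ ε * (S + S) := by
            refine mul_le_mul_of_nonneg_left (add_le_add le_rfl ?_) hε0.le
            exact Finset.sum_le_sum fun x hx => hanti x (Finset.mem_Ico.1 hx).1
    have hnS : n * q n ≤ S + q n := by
      have : ∑ x ∈ Finset.Ico 1 n, q n ≤ S :=
        Finset.sum_le_sum fun x hx => hanti' x n (Finset.mem_Ico.1 hx).1 (Finset.mem_Ico.1 hx).2.le
      rw [Finset.sum_const, nsmul_eq_mul, Nat.card_Ico, Nat.cast_sub (by omega)] at this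
      push_cast at this ⊢
      linarith
    have hr := hrec n (by omega)
    simp only [mul_sub, mul_one, Finset.sum_sub_distrib] at hr
    rw [← hS] at hr
    have h5 := mul_le_mul_of_nonneg_left hconv (by linarith : 0 ≤ c)
    nlinarith [hq1 n]
  have hdiv : ∀ n, 1 ≤ n → q n
      = 1 / n + c * ((∑ x ∈ Finset.Ico 1 n, q x * (1 - q (n + 1 - x))) / n) := by
    intro n hn
    have : (n : ℝ) ≠ 0 := by positivity
    field_simp
    linarith [hrec n hn]
  have hinv : Tendsto (fun n : ℕ => 1 / (n : ℝ)) atTop (nhds 0) :=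
    tendsto_const_div_atTop_nhds_zero_nat _
  have hub : ρ ≤ c * (1 - ρ) * ρ := by
    have h1 : Tendsto (fun n : ℕ => 1 / (n : ℝ) + c * (1 - ρ) *
        ((∑ x ∈ Finset.Ico 1 n, q x) / n)) atTop (nhds (0 + c * (1 - ρ) * ρ)) :=
      hinv.add ((tendsto_sum_Ico_div hlim).const_mul _)
    rw [zero_add] at h1
    refine le_of_tendsto_of_tendsto hlim h1 ?_
    filter_upwards [eventually_ge_atTop 1] with n hn
    rw [hdiv n hn, mul_assoc, ← mul_div_assoc (1 - ρ), mul_comm (1 - ρ), Finset.sum_mul]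
    gcongr with x hx
    · exact hq0 x
    · exact hρ (n + 1 - x) (by have := Finset.mem_Ico.1 hx; omega)
  have hlb : c * ρ * (1 - ρ) ≤ ρ := by
    have hlim' : Tendsto (fun n => 1 - q (n + 1)) atTop (nhds (1 - ρ)) :=
      ((tendsto_add_atTop_iff_nat 1).2 hlim).const_sub 1
    have h1 : Tendsto (fun n : ℕ => 1 / (n : ℝ) + c * ρ *
        ((∑ x ∈ Finset.Ico 1 n, (1 - q (x + 1))) / n)) atTop (nhds (0 + c * ρ * (1 - ρ))) :=
      hinv.add ((tendsto_sum_Ico_div hlim').const_mul _)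
    rw [zero_add] at h1
    refine le_of_tendsto_of_tendsto h1 hlim ?_
    filter_upwards [eventually_ge_atTop 1] with n hn
    rw [hdiv n hn, mul_assoc, ← mul_div_assoc ρ, ← sum_Ico_one_reflect (fun x => 1 - q x),
      Finset.mul_sum]
    gcongr with x hx
    · linarith [hq1 (n + 1 - x)]
    · exact hρ x (Finset.mem_Ico.1 hx).1
  have h := le_antisymm hub (by linarith : c * (1 - ρ) * ρ ≤ ρ)
  exact mul_right_cancel₀ hρpos.ne' (by linarith)

lemma survivalLim_one_empty {p : ℝ} (hp : p ∈ Set.Ioo (2 / 3 : ℝ) 1) :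
    survivalLim p 1 ∅ = (3 * p - 2) / (2 * p - 1) := by
  have hp' : p ∈ Set.Icc (1 / 2 : ℝ) 1 := ⟨by linarith [hp.1], hp.2.le⟩
  have h1 : 0 < 1 - p := by linarith [hp.2]
  have h2 : 0 < 2 * p - 1 := by linarith [hp.1]
  have h := limit_of_renewal (q := reachProb p) (c := (2 * p - 1) / (1 - p))
    (by rw [lt_div_iff₀ h1]; linarith [hp.1])
    (fun n => (hitAbove_mem hp' 1 ∅).1) (fun n => (hitAbove_mem hp' 1 ∅).2)
    (hitAbove_of_ge one_pos (by simp) ∅) (fun n hn => reachProb_succ_le hp' hn)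
    (tendsto_reachProb hp') (fun n hn => mul_reachProb_eq ⟨hp'.1, hp.2⟩ hn)
  field_simp at h ⊢
  linarith

section Walk

variable {Ω : Type*}

/-- The set of sites from which the process has jumped left before time `n`. -/
def burntSites (X : ℕ → Ω → ℤ) : ℕ → Ω → Finset ℤ
  | 0, _ => ∅
  | n + 1, ω => if X (n + 1) ω = X n ω - 1 then insert (X n ω) (burntSites X n ω)
      else burntSites X n ω

lemma mem_burntSites {X : ℕ → Ω → ℤ} {n : ℕ} {ω : Ω} {x : ℤ} :
    x ∈ burntSites X n ω ↔ ∃ m < n, X m ω = x ∧ X (m + 1) ω = X m ω - 1 := by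
  induction n with
  | zero => simp [burntSites]
  | succ n ih =>
    have h : (∃ m < n + 1, X m ω = x ∧ X (m + 1) ω = X m ω - 1) ↔
        (∃ m < n, X m ω = x ∧ X (m + 1) ω = X m ω - 1) ∨
          (X n ω = x ∧ X (n + 1) ω = X n ω - 1) := by
      constructor
      · rintro ⟨m, hm, h⟩
        rcases Nat.lt_succ_iff_lt_or_eq.1 hm with h' | rfl
        · exact Or.inl ⟨m, h', h⟩
        · exact Or.inr h
      · rintro (⟨m, hm, h⟩ | h)
        · exact ⟨m, hm.trans n.lt_succ_self, h⟩
        · exact ⟨n, n.lt_succ_self, h⟩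
    rw [h, ← ih, burntSites]
    split_ifs with h1
    · rw [Finset.mem_insert, or_comm, eq_comm (a := x)]
      simp [h1]
    · simp [h1]

lemma mem_freshEvent_iff {X : ℕ → Ω → ℤ} {n : ℕ} {ω : Ω} :
    ω ∈ freshEvent X n ↔ X n ω ∉ burntSites X n ω := by
  rw [mem_burntSites]
  simp [freshEvent]

lemma natSA_mono (X : ℕ → Ω → ℤ) {m n : ℕ} (h : m ≤ n) : natSA X m ≤ natSA X n :=
  biSup_mono fun i hi => by
    simp only [Finset.mem_range] at hi ⊢
    omega

lemma measurable_natSA (X : ℕ → Ω → ℤ) {m n : ℕ} (h : m ≤ n) : Measurable[natSA X n] (X m) := by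
  refine Measurable.mono (comap_measurable (m := ⊤) (X m)) ?_ le_top
  exact le_iSup₂_of_le m (by simp only [Finset.mem_range]; omega) le_rfl

lemma measurable_natSA_comp_path (X : ℕ → Ω → ℤ) (n : ℕ) (φ : (Fin (n + 1) → ℤ) → ℝ) :
    Measurable[natSA X n] fun ω => φ fun i => X i ω := by
  let := natSA X n
  have h : Measurable fun ω => fun i : Fin (n + 1) => X i ω :=
    measurable_pi_lambda _ fun i => measurable_natSA X (by omega)
  exact (measurable_of_countable φ).comp h

lemma exists_burntSites_eq (X : ℕ → Ω → ℤ) (n : ℕ) :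
    ∃ β : (Fin (n + 1) → ℤ) → Finset ℤ, ∀ ω, burntSites X n ω = β fun i => X i ω := by
  induction n with
  | zero => exact ⟨fun _ => ∅, fun _ => rfl⟩
  | succ n ih =>
    obtain ⟨β, hβ⟩ := ih
    refine ⟨fun u => if u (Fin.last (n + 1)) = u (Fin.last n).castSucc - 1
      then insert (u (Fin.last n).castSucc) (β fun i => u i.castSucc)
      else β fun i => u i.castSucc, fun ω => ?_⟩
    rw [burntSites, hβ]
    rfl

lemma measurable_natSA_state (X : ℕ → Ω → ℤ) (n : ℕ) (f : ℤ → Finset ℤ → ℝ) :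
    Measurable[natSA X n] fun ω => f (X n ω) (burntSites X n ω) := by
  obtain ⟨β, hβ⟩ := exists_burntSites_eq X n
  simp only [hβ]
  exact measurable_natSA_comp_path X n fun u => f (u (Fin.last n)) (β u)

/-- The event that the process is positive up to time `n`. -/
def positiveUpTo (X : ℕ → Ω → ℤ) (n : ℕ) : Set Ω := {ω | ∀ m ≤ n, 0 < X m ω}

lemma measurableSet_positiveUpTo (X : ℕ → Ω → ℤ) (n : ℕ) :
    MeasurableSet[natSA X n] (positiveUpTo X n) := by
  let := natSA X n
  have : positiveUpTo X n = ⋂ m ∈ Set.Iic n, X m ⁻¹' Set.Ioi 0 := by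
    ext; simp [positiveUpTo]
  rw [this]
  exact MeasurableSet.biInter (Set.to_countable _) fun m hm =>
    measurable_natSA X hm measurableSet_Ioi

lemma hitTime_eq_top_iff {X : ℕ → Ω → ℤ} {x : ℤ} {ω : Ω} :
    hitTime X x ω = ⊤ ↔ ∀ n, X n ω ≠ x := by
  simp [hitTime, iInf_eq_top]

variable [MeasurableSpace Ω] {P : Measure Ω} {p : ℝ} {X : ℕ → Ω → ℤ}

lemma IsCookieRW.natSA_le {env : ℤ → ℝ} (hX : IsCookieRW P env X) (n : ℕ) :
    natSA X n ≤ ‹MeasurableSpace Ω› :=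
  iSup₂_le fun m _ => (hX.meas m).comap_le

variable [IsProbabilityMeasure P]

lemma IsCookieRW.integral_mul_indicator_up (hX : IsCookieRW P (fun _ => p) X) (n : ℕ)
    {g : Ω → ℝ} (hg : Measurable[natSA X n] g) {C : ℝ} (hC : ∀ ω, |g ω| ≤ C) :
    ∫ ω, g ω * Set.indicator {ω | X (n + 1) ω = X n ω + 1} (fun _ => (1 : ℝ)) ω ∂P
      = ∫ ω, g ω * rightProb p (X n ω) (burntSites X n ω) ∂P := by
  set U := Set.indicator {ω | X (n + 1) ω = X n ω + 1} (fun _ => (1 : ℝ)) with hU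
  have hUint : Integrable U P :=
    (integrable_const 1).indicator
      (measurableSet_eq_fun (hX.meas (n + 1)) ((hX.meas n).add_const 1))
  have h1 := condExp_stronglyMeasurable_mul_of_bound (hX.natSA_le n) hg.stronglyMeasurable hUint C
    (Eventually.of_forall hC)
  change ∫ ω, (g * U) ω ∂P = _
  rw [← integral_condExp (hX.natSA_le n) (f := g * U)]
  refine integral_congr_ae ?_
  filter_upwards [h1, hX.cond n] with ω h2 h3
  rw [h2, Pi.mul_apply, h3]
  by_cases h : X n ω ∈ burntSites X n ω
  · have : ω ∉ freshEvent X n := fun h' => mem_freshEvent_iff.1 h' h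
    simp [rightProb, h, this]
  · have : ω ∈ freshEvent X n := mem_freshEvent_iff.2 h
    simp [rightProb, h, this]

/-- The pair (position, burnt sites) is a Markov chain with transition operator `stepOp`. -/
lemma IsCookieRW.setIntegral_succ (hX : IsCookieRW P (fun _ => p) X) (n : ℕ) {A : Set Ω}
    (hA : MeasurableSet[natSA X n] A) {f : ℤ → Finset ℤ → ℝ} {C : ℝ} (hC : ∀ x B, |f x B| ≤ C) :
    ∫ ω in A, f (X (n + 1) ω) (burntSites X (n + 1) ω) ∂P
      = ∫ ω in A, stepOp p f (X n ω) (burntSites X n ω) ∂P := by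
  have hle := hX.natSA_le n
  set U := Set.indicator {ω | X (n + 1) ω = X n ω + 1} (fun _ => (1 : ℝ)) with hU
  set b : Ω → ℝ := A.indicator fun ω => f (X n ω - 1) (insert (X n ω) (burntSites X n ω)) with hb
  set d : Ω → ℝ := A.indicator fun ω => f (X n ω + 1) (burntSites X n ω)
    - f (X n ω - 1) (insert (X n ω) (burntSites X n ω)) with hd
  have hbm : Measurable[natSA X n] b :=
    (measurable_natSA_state X n fun x B => f (x - 1) (insert x B)).indicator hA
  have hdm : Measurable[natSA X n] d :=
    (measurable_natSA_state X n fun x B => f (x + 1) B - f (x - 1) (insert x B)).indicator hA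
  have hC0 : 0 ≤ C := (abs_nonneg _).trans (hC 0 ∅)
  have hbC : ∀ ω, |b ω| ≤ C := by
    intro ω
    by_cases hω : ω ∈ A
    · simpa only [hb, Set.indicator_of_mem hω] using hC _ _
    · simpa [hb, hω] using hC0
  have hdC : ∀ ω, |d ω| ≤ C + C := by
    intro ω
    by_cases hω : ω ∈ A
    · simpa only [hd, Set.indicator_of_mem hω] using
        (abs_sub _ _).trans (add_le_add (hC _ _) (hC _ _))
    · simpa [hd, hω] using hC0
  have hUm : Measurable U := measurable_const.indicator
    (measurableSet_eq_fun (hX.meas (n + 1)) ((hX.meas n).add_const 1))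
  have hwm : Measurable fun ω => rightProb p (X n ω) (burntSites X n ω) :=
    (measurable_natSA_state X n (rightProb p)).mono hle le_rfl
  have hbi : Integrable b P :=
    .of_bound (hbm.mono hle le_rfl).aestronglyMeasurable C (Eventually.of_forall hbC)
  have hdi : Integrable d P :=
    .of_bound (hdm.mono hle le_rfl).aestronglyMeasurable (C + C) (Eventually.of_forall hdC)
  have hdU : Integrable (fun ω => d ω * U ω) P := by
    refine hdi.mul_bdd (c := 1) hUm.aestronglyMeasurable (Eventually.of_forall fun ω => ?_)
    rw [hU, Set.indicator_apply]
    split_ifs <;> simp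
  have hdw : Integrable (fun ω => d ω * rightProb p (X n ω) (burntSites X n ω)) P := by
    refine hdi.mul_bdd (c := max |1 / 2| |p|) hwm.aestronglyMeasurable
      (Eventually.of_forall fun ω => ?_)
    rw [rightProb, Real.norm_eq_abs]
    split_ifs
    · exact le_max_left _ _
    · exact le_max_right _ _
  have hAm := hle _ hA
  calc ∫ ω in A, f (X (n + 1) ω) (burntSites X (n + 1) ω) ∂P
      = ∫ ω, b ω + d ω * U ω ∂P := by
        rw [← integral_indicator hAm]
        refine integral_congr_ae ?_
        filter_upwards [hX.steps n] with ω h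
        by_cases hω : ω ∈ A
        · simp only [hb, hd, hU, Set.indicator_of_mem hω]
          rcases (abs_eq zero_le_one).1 h with h' | h'
          · have h1 : X (n + 1) ω = X n ω + 1 := by omega
            simp [burntSites, h1, show X n ω + 1 ≠ X n ω - 1 by omega]
          · have h1 : X (n + 1) ω = X n ω - 1 := by omega
            simp [burntSites, h1, show X n ω - 1 ≠ X n ω + 1 by omega]
        · simp [hb, hd, hω]
    _ = ∫ ω, b ω + d ω * rightProb p (X n ω) (burntSites X n ω) ∂P := by
        rw [integral_add hbi hdU, integral_add hbi hdw, hX.integral_mul_indicator_up n hdm hdC]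
    _ = ∫ ω in A, stepOp p f (X n ω) (burntSites X n ω) ∂P := by
        rw [← integral_indicator hAm]
        congr 1
        ext ω
        by_cases hω : ω ∈ A
        · simp only [hb, hd, Set.indicator_of_mem hω, stepOp]
          ring
        · simp [hb, hd, hω]

lemma IsCookieRW.setIntegral_survivalProb_succ (hX : IsCookieRW P (fun _ => p) X)
    (hp : p ∈ Set.Icc (1 / 2 : ℝ) 1) (n k : ℕ) :
    ∫ ω in positiveUpTo X n, survivalProb p (k + 1) (X n ω) (burntSites X n ω) ∂P
      = ∫ ω in positiveUpTo X (n + 1),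
          survivalProb p k (X (n + 1) ω) (burntSites X (n + 1) ω) ∂P := by
  have hA : ∀ n, MeasurableSet (positiveUpTo X n) := fun n =>
    hX.natSA_le n _ (measurableSet_positiveUpTo X n)
  have h1 : ∫ ω in positiveUpTo X n, survivalProb p (k + 1) (X n ω) (burntSites X n ω) ∂P
      = ∫ ω in positiveUpTo X n, stepOp p (survivalProb p k) (X n ω) (burntSites X n ω) ∂P := by
    refine setIntegral_congr_fun (hA n) fun ω hω => ?_
    simp [survivalProb, (hω n le_rfl).not_ge]
  rw [h1, ← hX.setIntegral_succ n (measurableSet_positiveUpTo X n) (C := 1) fun x B => ?_,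
    ← integral_indicator (hA n), ← integral_indicator (hA (n + 1))]
  · congr 1
    ext ω
    by_cases h : ω ∈ positiveUpTo X (n + 1)
    · have h' : ω ∈ positiveUpTo X n := fun m hm => h m (by omega)
      simp [h, h']
    · by_cases h' : ω ∈ positiveUpTo X n
      · have h2 : X (n + 1) ω ≤ 0 := by
          by_contra h3
          refine h fun m hm => ?_
          rcases hm.lt_or_eq with hm | rfl
          · exact h' m (by omega)
          · omega
        simp [h, h', survivalProb_of_nonpos k h2]
      · simp [h, h']
  · have := survivalProb_mem hp k x B
    exact abs_le.2 ⟨by linarith [this.1], this.2⟩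

lemma IsCookieRW.measureReal_positiveUpTo (hX : IsCookieRW P (fun _ => p) X)
    (hp : p ∈ Set.Icc (1 / 2 : ℝ) 1) (hX0 : ∀ᵐ ω ∂P, X 0 ω = 1) (k : ℕ) :
    P.real (positiveUpTo X k) = survivalProb p k 1 ∅ := by
  have hA : ∀ n, MeasurableSet (positiveUpTo X n) := fun n =>
    hX.natSA_le n _ (measurableSet_positiveUpTo X n)
  have h : ∀ n k, ∫ ω in positiveUpTo X 0, survivalProb p (n + k) (X 0 ω) (burntSites X 0 ω) ∂P
      = ∫ ω in positiveUpTo X n, survivalProb p k (X n ω) (burntSites X n ω) ∂P := by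
    intro n
    induction n with
    | zero => simp
    | succ n ih =>
      intro k
      rw [← hX.setIntegral_survivalProb_succ hp, ← ih, show n + 1 + k = n + (k + 1) by omega]
  have h0 : ∫ ω in positiveUpTo X 0, survivalProb p k (X 0 ω) (burntSites X 0 ω) ∂P
      = survivalProb p k 1 ∅ := by
    rw [← integral_indicator (hA 0)]
    trans ∫ _, survivalProb p k 1 ∅ ∂P
    · refine integral_congr_ae ?_
      filter_upwards [hX0] with ω hω
      rw [Set.indicator_of_mem (by simp [positiveUpTo, hω]), hω, burntSites]
    · simp
  have hk : ∫ ω in positiveUpTo X k, survivalProb p 0 (X k ω) (burntSites X k ω) ∂P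
      = P.real (positiveUpTo X k) := by
    trans ∫ ω in positiveUpTo X k, (1 : ℝ) ∂P
    · refine setIntegral_congr_fun (hA k) fun ω hω => ?_
      simp [survivalProb, (hω k le_rfl).not_ge]
    · simp
  rw [← hk, ← h k 0, add_zero, h0]

lemma IsCookieRW.measureReal_hitTime_eq_top (hX : IsCookieRW P (fun _ => p) X)
    (hp : p ∈ Set.Icc (1 / 2 : ℝ) 1) (hX0 : ∀ᵐ ω ∂P, X 0 ω = 1) :
    P.real {ω | hitTime X 0 ω = ⊤} = survivalLim p 1 ∅ := by
  have h1 : {ω | hitTime X 0 ω = ⊤} =ᵐ[P] ⋂ k, positiveUpTo X k := by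
    filter_upwards [hX0, ae_all_iff.2 hX.steps] with ω h0 hs
    refine propext ?_
    change hitTime X 0 ω = ⊤ ↔ ω ∈ ⋂ k, positiveUpTo X k
    rw [hitTime_eq_top_iff, Set.mem_iInter]
    constructor
    · intro h k m _
      induction m with
      | zero => omega
      | succ m ih =>
        have h2 := ih (by omega)
        have h3 := h (m + 1)
        rcases (abs_eq zero_le_one).1 (hs m) with h4 | h4 <;> omega
    · intro h n
      exact (h n n le_rfl).ne'
  rw [measureReal_congr h1]
  have hanti : Antitone (positiveUpTo X) := fun m n hmn ω hω i hi => hω i (hi.trans hmn)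
  have h2 := tendsto_measure_iInter_atTop (μ := P)
    (fun k => (hX.natSA_le k _ (measurableSet_positiveUpTo X k)).nullMeasurableSet) hanti
    ⟨0, measure_ne_top _ _⟩
  have h3 := (ENNReal.tendsto_toReal (measure_ne_top P _)).comp h2
  refine tendsto_nhds_unique h3 ((tendsto_survivalProb hp 1 ∅).congr fun k => ?_)
  exact (hX.measureReal_positiveUpTo hp hX0 k).symm

end Walk

/-- For `p ∈ (2/3, 1)` the probability that the homogeneous walk started at `1` never hits
`0` satisfies `(3p-2)/p ≤ P(T₀ = ∞) ≤ (3p-2)/(p(2p-1))`; in particular it is positive. -/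
theorem stmt4 (p : ℝ) (hp : p ∈ Set.Ioo (2 / 3 : ℝ) 1)
    {Ω : Type*} [MeasurableSpace Ω] (P : Measure Ω) [IsProbabilityMeasure P]
    (X : ℕ → Ω → ℤ) (hX : IsCookieRW P (fun _ => p) X) (hX0 : ∀ᵐ ω ∂P, X 0 ω = 1) :
    (3 * p - 2) / p ≤ (P {ω | hitTime X 0 ω = ⊤}).toReal ∧
    (P {ω | hitTime X 0 ω = ⊤}).toReal ≤ (3 * p - 2) / (p * (2 * p - 1)) ∧
    0 < P {ω | hitTime X 0 ω = ⊤} := by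
  have hp2 := hp.1
  have hp1 := hp.2
  have h : (P {ω | hitTime X 0 ω = ⊤}).toReal = (3 * p - 2) / (2 * p - 1) :=
    (hX.measureReal_hitTime_eq_top ⟨by linarith, hp1.le⟩ hX0).trans (survivalLim_one_empty hp)
  have h1 : 0 < 2 * p - 1 := by linarith
  have h2 : 0 < 3 * p - 2 := by linarith
  refine ⟨?_, ?_, ?_⟩
  · rw [h]
    exact div_le_div_of_nonneg_left h2.le h1 (by linarith)
  · rw [h]
    exact div_le_div_of_nonneg_left h2.le (by nlinarith) (by nlinarith)
  · exact (ENNReal.toReal_pos_iff.1 (h ▸ div_pos h2 h1)).1
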